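/- Suppose that Ω is convex with Ω ⊆ int dom F, that the graph gph F := {(x,y) ∈ ℝⁿ×ℝᵐ | y ∈ F(x)} is convex, and that F is locally bounded at every point of Ω (for each x̄ ∈ Ω there exist α > 0 and a neighborhood U of x̄ with ⋃_{x∈U} F(x) contained in the closed ball of radius α). Then (SP) satisfies (wFDVP) with p := n+1, i.e. wargmin_x(VP_{n+1}) = wargmin(SP). -/

import Mathlib

open Set Pointwise

noncomputable section

/-- The set `A - v` (translate of `A` by `-v`). -/
def shiftSet {m : ℕ} (A : Set (Fin m → ℝ)) (v : Fin m → ℝ) : Set (Fin m → ℝ) :=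
  (fun y => y - v) '' A

/-- `ε`-weakly minimal solutions of the set optimization problem (SP). -/
def SPwmin {n m : ℕ} (Ω : Set (Fin n → ℝ)) (F : (Fin n → ℝ) → Set (Fin m → ℝ))
    (K : Set (Fin m → ℝ)) (e : Fin m → ℝ) (ε : ℝ) : Set (Fin n → ℝ) :=
  {xb | xb ∈ Ω ∧ ¬ ∃ x ∈ Ω, shiftSet (F xb) (ε • e) ⊆ F x + interior K}

/-- Type-one `ε`-minimal solutions of (SP). -/
def SPargmin1 {n m : ℕ} (Ω : Set (Fin n → ℝ)) (F : (Fin n → ℝ) → Set (Fin m → ℝ))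
    (K : Set (Fin m → ℝ)) (e : Fin m → ℝ) (ε : ℝ) : Set (Fin n → ℝ) :=
  {xb | xb ∈ Ω ∧ ∀ x ∈ Ω,
    shiftSet (F xb) (ε • e) ⊆ F x + K → F x ⊆ shiftSet (F xb) (ε • e) + K}

/-- Type-two `ε`-minimal solutions of (SP). -/
def SPargmin2 {n m : ℕ} (Ω : Set (Fin n → ℝ)) (F : (Fin n → ℝ) → Set (Fin m → ℝ))
    (K : Set (Fin m → ℝ)) (e : Fin m → ℝ) (ε : ℝ) : Set (Fin n → ℝ) :=
  {xb | xb ∈ Ω ∧ ¬ ∃ x ∈ Ω, shiftSet (F xb) (ε • e) ⊆ F x + (K \ {0})}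

/-- Feasibility for the multiobjective problem (VP_p). -/
def VPfeas {n m : ℕ} (Ω : Set (Fin n → ℝ)) (F : (Fin n → ℝ) → Set (Fin m → ℝ))
    (p : ℕ) (x : Fin n → ℝ) (y : Fin p → Fin m → ℝ) : Prop :=
  x ∈ Ω ∧ ∀ i, y i ∈ F x

/-- `(xb, yb¹, …, ybᵖ)` is an `ε`-weakly minimal solution of (VP_p). -/
def VPwSol {n m : ℕ} (Ω : Set (Fin n → ℝ)) (F : (Fin n → ℝ) → Set (Fin m → ℝ))
    (K : Set (Fin m → ℝ)) (e : Fin m → ℝ) (p : ℕ) (ε : ℝ)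
    (xb : Fin n → ℝ) (yb : Fin p → Fin m → ℝ) : Prop :=
  VPfeas Ω F p xb yb ∧
    ¬ ∃ x y, VPfeas Ω F p x y ∧ ∀ i, (yb i - ε • e) - y i ∈ interior K

/-- Projection onto the `x`-component of the `ε`-weakly minimal solutions of (VP_p). -/
def VPwX {n m : ℕ} (Ω : Set (Fin n → ℝ)) (F : (Fin n → ℝ) → Set (Fin m → ℝ))
    (K : Set (Fin m → ℝ)) (e : Fin m → ℝ) (p : ℕ) (ε : ℝ) : Set (Fin n → ℝ) :=
  {xb | ∃ yb, VPwSol Ω F K e p ε xb yb}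

/-- `(xb, yb¹, …, ybᵖ)` is an `ε`-minimal solution of (VP_p). -/
def VPmSol {n m : ℕ} (Ω : Set (Fin n → ℝ)) (F : (Fin n → ℝ) → Set (Fin m → ℝ))
    (K : Set (Fin m → ℝ)) (e : Fin m → ℝ) (p : ℕ) (ε : ℝ)
    (xb : Fin n → ℝ) (yb : Fin p → Fin m → ℝ) : Prop :=
  VPfeas Ω F p xb yb ∧
    ¬ ∃ x y, VPfeas Ω F p x y ∧ (∀ i, (yb i - ε • e) - y i ∈ K) ∧
      y ≠ fun i => yb i - ε • e

/-- Projection onto the `x`-component of the `ε`-minimal solutions of (VP_p). -/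
def VPmX {n m : ℕ} (Ω : Set (Fin n → ℝ)) (F : (Fin n → ℝ) → Set (Fin m → ℝ))
    (K : Set (Fin m → ℝ)) (e : Fin m → ℝ) (p : ℕ) (ε : ℝ) : Set (Fin n → ℝ) :=
  {xb | ∃ yb, VPmSol Ω F K e p ε xb yb}

/-- Minimal elements of `A` with respect to the cone `K`. -/
def MinSet {m : ℕ} (A K : Set (Fin m → ℝ)) : Set (Fin m → ℝ) :=
  {y | y ∈ A ∧ ({y} - K) ∩ A = {y}}

/-- Weakly minimal elements of `A` with respect to the cone `K`. -/
def WMinSet {m : ℕ} (A K : Set (Fin m → ℝ)) : Set (Fin m → ℝ) :=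
  {y | y ∈ A ∧ ({y} - interior K) ∩ A = ∅}

/-- Euclidean dot product. -/
def dot {k : ℕ} (a b : Fin k → ℝ) : ℝ := ∑ i, a i * b i

/-- Graph of a set-valued mapping. -/
def gph {n m : ℕ} (F : (Fin n → ℝ) → Set (Fin m → ℝ)) :
    Set ((Fin n → ℝ) × (Fin m → ℝ)) :=
  {q | q.2 ∈ F q.1}

/-- Normal cone (of convex analysis) to a subset of the product space. -/
def normalConeProd {n m : ℕ} (C : Set ((Fin n → ℝ) × (Fin m → ℝ)))
    (qb : (Fin n → ℝ) × (Fin m → ℝ)) : Set ((Fin n → ℝ) × (Fin m → ℝ)) :=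
  {w | ∀ q ∈ C, dot w.1 (q.1 - qb.1) + dot w.2 (q.2 - qb.2) ≤ 0}

/-- Dual cone. -/
def dualCone {m : ℕ} (K : Set (Fin m → ℝ)) : Set (Fin m → ℝ) :=
  {v | ∀ y ∈ K, 0 ≤ dot v y}

/-- Coderivative of a set-valued mapping with convex graph. -/
def coderiv {n m : ℕ} (F : (Fin n → ℝ) → Set (Fin m → ℝ))
    (xb : Fin n → ℝ) (yb : Fin m → ℝ) (v : Fin m → ℝ) : Set (Fin n → ℝ) :=
  {u | (u, -v) ∈ normalConeProd (gph F) (xb, yb)}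

lemma aux_addK {m : ℕ} {K : Set (Fin m → ℝ)} (hKconv : Convex ℝ K)
    (hKcone : ∀ t : ℝ, 0 ≤ t → ∀ y ∈ K, t • y ∈ K) {a b : Fin m → ℝ}
    (ha : a ∈ K) (hb : b ∈ K) : a + b ∈ K := by
  have h := hKconv ha hb (by norm_num : (0:ℝ) ≤ 1/2) (by norm_num : (0:ℝ) ≤ 1/2) (by norm_num)
  have h2 := hKcone 2 (by norm_num) _ h
  convert h2 using 1
  rw [smul_add, smul_smul, smul_smul]
  norm_num

lemma aux_addint {m : ℕ} {K : Set (Fin m → ℝ)} (hKconv : Convex ℝ K)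
    (hKcone : ∀ t : ℝ, 0 ≤ t → ∀ y ∈ K, t • y ∈ K) {a b : Fin m → ℝ}
    (ha : a ∈ interior K) (hb : b ∈ K) : a + b ∈ interior K := by
  have hop : IsOpen (interior K + K) := isOpen_interior.add_right
  have hsub : interior K + K ⊆ K := by
    rintro _ ⟨u, hu, v, hv, rfl⟩
    exact aux_addK hKconv hKcone (interior_subset hu) hv
  exact interior_maximal hsub hop ⟨a, ha, b, hb, rfl⟩

lemma aux_sumint {m : ℕ} {A K : Set (Fin m → ℝ)} (hKconv : Convex ℝ K)
    (hKcone : ∀ t : ℝ, 0 ≤ t → ∀ y ∈ K, t • y ∈ K) {a b : Fin m → ℝ}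
    (ha : a ∈ A + interior K) (hb : b ∈ K) : a + b ∈ A + interior K := by
  obtain ⟨u, hu, v, hv, rfl⟩ := ha
  exact ⟨u, hu, v + b, aux_addint hKconv hKcone hv hb, by simp [add_assoc]⟩

lemma aux_convex {n m : ℕ} {Ω : Set (Fin n → ℝ)} {F : (Fin n → ℝ) → Set (Fin m → ℝ)}
    {K : Set (Fin m → ℝ)} (hKconv : Convex ℝ K) (hΩconv : Convex ℝ Ω)
    (hconv : Convex ℝ (gph F)) (y : Fin m → ℝ) :
    Convex ℝ {x | x ∈ Ω ∧ y ∈ F x + interior K} := by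
  rintro x ⟨hx, u, hu, k, hk, h⟩ x' ⟨hx', u', hu', k', hk', h'⟩ a b ha hb hab
  refine ⟨hΩconv hx hx' ha hb hab, a • u + b • u', ?_, a • k + b • k',
    hKconv.interior hk hk' ha hb hab, ?_⟩
  · exact @hconv (x, u) hu (x', u') hu' a b ha hb hab
  · have h1 : u + k = y := h
    have h2 : u' + k' = y := h'
    show a • u + b • u' + (a • k + b • k') = y
    calc _ = a • (u + k) + b • (u' + k') := by simp only [smul_add]; abel
      _ = y := by rw [h1, h2, ← add_smul, hab, one_smul]

lemma aux_main {n m : ℕ}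
    {Ω : Set (Fin n → ℝ)} {F : (Fin n → ℝ) → Set (Fin m → ℝ)}
    {K : Set (Fin m → ℝ)} {e : Fin m → ℝ}
    (hΩne : Ω.Nonempty) (hKconv : Convex ℝ K)
    (hKcone : ∀ t : ℝ, 0 ≤ t → ∀ y ∈ K, t • y ∈ K)
    (he : e ∈ interior K) (hΩconv : Convex ℝ Ω) (hconv : Convex ℝ (gph F))
    {A : Set (Fin m → ℝ)} (hA : IsCompact A)
    (h : ∀ y : Fin (n + 1) → Fin m → ℝ, (∀ i, y i ∈ A) → ∃ x ∈ Ω, ∀ i, y i ∈ F x + interior K) :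
    ∃ x ∈ Ω, A ⊆ F x + interior K := by
  classical
  -- uniform slack
  have hslack : ∃ ε : ℝ, 0 < ε ∧ ∀ y : Fin (n + 1) → Fin m → ℝ, (∀ i, y i ∈ A) →
      ∃ x ∈ Ω, ∀ i, y i - ε • e ∈ F x + interior K := by
    let V : ℕ → Set (Fin (n + 1) → Fin m → ℝ) := fun k =>
      ⋃ x ∈ Ω, ⋂ i, (fun y : Fin (n + 1) → Fin m → ℝ => y i - (1 / ((k : ℝ) + 1)) • e) ⁻¹'
        (F x + interior K)
    have hVo : ∀ k, IsOpen (V k) := by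
      intro k
      refine isOpen_biUnion fun x _ => isOpen_iInter_of_finite fun i => ?_
      exact (isOpen_interior.add_left).preimage (by fun_prop)
    have hVm : Monotone V := by
      intro k l hkl y hy
      simp only [V, mem_iUnion, mem_iInter, mem_preimage] at hy ⊢
      obtain ⟨x, hx, hy⟩ := hy
      refine ⟨x, hx, fun i => ?_⟩
      have hle : (1 / ((l : ℝ) + 1)) ≤ 1 / ((k : ℝ) + 1) := Nat.one_div_le_one_div hkl
      have := aux_sumint hKconv hKcone (hy i)
        (hKcone _ (sub_nonneg.2 hle) e (interior_subset he))
      convert this using 1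
      rw [sub_smul]; abel
    have hcpt : IsCompact (Set.pi univ fun _ : Fin (n + 1) => A) :=
      isCompact_univ_pi fun _ => hA
    obtain ⟨k, hk⟩ := hcpt.elim_directed_cover V hVo (by
      intro y hy
      obtain ⟨x, hx, hxy⟩ := h y fun i => hy i (mem_univ i)
      have hev : ∀ i, ∀ᶠ k : ℕ in Filter.atTop,
          y i - (1 / ((k : ℝ) + 1)) • e ∈ F x + interior K := by
        intro i
        have ht : Filter.Tendsto (fun k : ℕ => y i - (1 / ((k : ℝ) + 1)) • e) Filter.atTop
            (nhds (y i - (0 : ℝ) • e)) :=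
          tendsto_const_nhds.sub (tendsto_one_div_add_atTop_nhds_zero_nat.smul_const e)
        rw [zero_smul, sub_zero] at ht
        exact ht.eventually (isOpen_interior.add_left.mem_nhds (hxy i))
      obtain ⟨k, hk⟩ := (Filter.eventually_all.2 hev).exists
      simp only [V, mem_iUnion, mem_iInter, mem_preimage]
      exact ⟨k, x, hx, hk⟩) hVm.directed_le
    refine ⟨1 / ((k : ℝ) + 1), by positivity, fun y hy => ?_⟩
    have := hk (show y ∈ Set.pi univ fun _ : Fin (n + 1) => A from fun i _ => hy i)
    simp only [V, mem_iUnion, mem_iInter, mem_preimage] at this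
    obtain ⟨x, hx, hh⟩ := this
    exact ⟨x, hx, hh⟩
  obtain ⟨ε, hε, hs⟩ := hslack
  have hεe : ε • e ∈ interior K := by
    have hsm : ε • interior K ⊆ interior K := by
      refine interior_maximal ?_ (isOpen_interior.smul₀ hε.ne')
      rintro _ ⟨u, hu, rfl⟩
      exact hKcone ε hε.le u (interior_subset hu)
    exact hsm ⟨e, he, rfl⟩
  -- finite net
  obtain ⟨t, htA, ht⟩ := hA.elim_nhds_subcover
    (fun c => (fun y => y - (c - ε • e)) ⁻¹' interior K) (by
      intro c _
      refine (isOpen_interior.preimage (by fun_prop)).mem_nhds ?_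
      simpa using hεe)
  have hhelly := Convex.helly_theorem' (𝕜 := ℝ)
    (F := fun y : Fin m → ℝ => {x : Fin n → ℝ | x ∈ Ω ∧ y - ε • e ∈ F x + interior K}) (s := t)
    (fun y _ => aux_convex hKconv hΩconv hconv _) (by
      intro I hI hcard
      rcases I.eq_empty_or_nonempty with rfl | hne
      · simp
      have hcard' : I.card ≤ n + 1 := by simpa using hcard
      haveI : Nonempty I := hne.to_subtype
      obtain ⟨f⟩ : Nonempty (I ↪ Fin (n + 1)) :=
        Function.Embedding.nonempty_of_card_le (by simpa using hcard')
      obtain ⟨x, hx, hxy⟩ := hs (fun i => (Function.invFun f i : I).1)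
        (fun i => htA _ (hI (Function.invFun f i : I).2))
      refine ⟨x, ?_⟩
      simp only [mem_iInter]
      intro y hy
      refine ⟨hx, ?_⟩
      have := hxy (f ⟨y, hy⟩)
      rwa [Function.leftInverse_invFun f.injective] at this)
  obtain ⟨x, hx⟩ := hhelly
  simp only [mem_iInter] at hx
  by_cases hAne : A.Nonempty
  · obtain ⟨a, ha⟩ := hAne
    have hcov : ∀ y ∈ A, x ∈ Ω ∧ y ∈ F x + interior K := by
      intro y hy
      have := ht hy
      simp only [mem_iUnion] at this
      obtain ⟨c, hc, hyc⟩ := this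
      obtain ⟨h1, h2⟩ := hx c hc
      refine ⟨h1, ?_⟩
      have := aux_sumint hKconv hKcone h2 (interior_subset hyc)
      simpa using this
    exact ⟨x, (hcov a ha).1, fun y hy => (hcov y hy).2⟩
  · obtain ⟨x0, hx0⟩ := hΩne
    exact ⟨x0, hx0, fun y hy => (hAne ⟨y, hy⟩).elim⟩

theorem stmt19 (n m : ℕ)
    (Ω : Set (Fin n → ℝ)) (F : (Fin n → ℝ) → Set (Fin m → ℝ))
    (K : Set (Fin m → ℝ)) (e : Fin m → ℝ)
    (hΩne : Ω.Nonempty) (hΩcl : IsClosed Ω)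
    (hdom : ∀ x ∈ Ω, (F x).Nonempty) (hFcpt : ∀ x ∈ Ω, IsCompact (F x))
    (hKcl : IsClosed K) (hKconv : Convex ℝ K)
    (hKcone : ∀ t : ℝ, 0 ≤ t → ∀ y ∈ K, t • y ∈ K)
    (hKpointed : K ∩ (-K) = {0})
    (he : e ∈ interior K)
    (hΩconv : Convex ℝ Ω)
    (hΩint : Ω ⊆ interior {x | (F x).Nonempty})
    (hconv : Convex ℝ (gph F))
    (hlb : ∀ xb ∈ Ω, ∃ α : ℝ, 0 < α ∧ ∃ U ∈ nhds xb,
      (⋃ x ∈ U, F x) ⊆ Metric.closedBall 0 α) :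
    VPwX Ω F K e (n + 1) 0 = SPwmin Ω F K e 0 := by
  have hsh : ∀ A : Set (Fin m → ℝ), shiftSet A 0 = A := by
    intro A; simp [shiftSet]
  ext xb
  simp only [VPwX, SPwmin, VPwSol, VPfeas, mem_ofPred_eq, hsh, zero_smul, sub_zero]
  constructor
  · rintro ⟨yb, ⟨hxb, hyb⟩, hno⟩
    refine ⟨hxb, ?_⟩
    rintro ⟨x, hx, hsub⟩
    have : ∀ i, ∃ z ∈ F x, yb i - z ∈ interior K := by
      intro i
      obtain ⟨z, hz, k, hk, hzk⟩ := hsub (hyb i)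
      refine ⟨z, hz, ?_⟩
      have hzk' : z + k = yb i := hzk
      rw [← hzk']
      simpa using hk
    choose y hy hyk using this
    exact hno ⟨x, y, ⟨hx, hy⟩, hyk⟩
  · rintro ⟨hxb, hno⟩
    by_contra hcon
    apply hno
    refine aux_main hΩne hKconv hKcone he hΩconv hconv (hFcpt xb hxb) ?_
    intro yb hyb
    by_contra hc
    refine hcon ⟨yb, ⟨hxb, hyb⟩, ?_⟩
    rintro ⟨x, y, ⟨hx, hy⟩, hk⟩
    exact hc ⟨x, hx, fun i => ⟨y i, hy i, yb i - y i, hk i, by simp⟩⟩
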